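/- Let A be a bounded residuated lattice and m, n > 0 such that for every a ∈ A the element m.(aⁿ) is Boolean. Then for every integer k ≥ max{m, n} and every a ∈ A, k.a ∨ k.(¬a) = ⊤. -/

import Mathlib

universe u

/-- A bounded (integral, commutative) residuated lattice: a bounded lattice
with a commutative monoid operation `mul` (with unit `⊤`) and a residuum
`himp` satisfying the residuation condition. -/
class BRL (α : Type u) extends Lattice α, BoundedOrder α where
  mul : α → α → α
  himp : α → α → α
  mul_comm : ∀ a b : α, mul a b = mul b a
  mul_assoc : ∀ a b c : α, mul (mul a b) c = mul a (mul b c)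
  mul_top : ∀ a : α, mul a ⊤ = a
  residuation : ∀ a b c : α, mul a b ≤ c ↔ a ≤ himp b c

namespace BRL

variable {α : Type u} [BRL α]

/-- `¬a := a → ⊥`. -/
def neg (a : α) : α := himp a ⊥

/-- `a + b := ¬(¬a · ¬b)`. -/
def add (a b : α) : α := neg (mul (neg a) (neg b))

/-- Powers: `a⁰ = ⊤`, `aⁿ⁺¹ = a · aⁿ`. -/
def pow (a : α) : ℕ → α
  | 0 => ⊤
  | n + 1 => mul a (pow a n)

/-- Multiples: `0.a = ⊥`, `(n+1).a = a + n.a`. -/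
def nmul : ℕ → α → α
  | 0, _ => ⊥
  | n + 1, a => add a (nmul n a)

/-- Implicative filter. -/
def IsFilter (F : Set α) : Prop :=
  ⊤ ∈ F ∧ (∀ a b : α, a ∈ F → a ≤ b → b ∈ F) ∧
    (∀ a b : α, a ∈ F → b ∈ F → mul a b ∈ F)

/-- The smallest implicative filter containing `S`. -/
def genFilter (S : Set α) : Set α := ⋂₀ {F : Set α | IsFilter F ∧ S ⊆ F}

/-- Maximal (proper) implicative filter. -/
def IsMaximal (M : Set α) : Prop :=
  IsFilter M ∧ M ≠ Set.univ ∧ ∀ G : Set α, IsFilter G → M ⊂ G → G = Set.univ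

/-- Prime (proper) implicative filter. -/
def IsPrime (P : Set α) : Prop :=
  IsFilter P ∧ P ≠ Set.univ ∧ ∀ a b : α, a ⊔ b ∈ P → a ∈ P ∨ b ∈ P

/-- Minimal prime implicative filter (minimal among prime implicative filters). -/
def IsMinimalPrime (P : Set α) : Prop :=
  IsPrime P ∧ ∀ Q : Set α, IsPrime Q → Q ⊆ P → Q = P

/-- The radical: intersection of all maximal implicative filters. -/
def Rad : Set α := {a : α | ∀ M : Set α, IsMaximal M → a ∈ M}

/-- Boolean (complemented) element. -/
def Boolean (b : α) : Prop := b ⊔ neg b = ⊤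

/-- Stone ultrafilter: an implicative filter generated by an ultrafilter of
the Boolean algebra of Boolean elements. -/
def IsStoneUltra (F : Set α) : Prop :=
  IsFilter F ∧ F = genFilter (F ∩ {b : α | Boolean b}) ∧ (⊥ : α) ∉ F ∧
    ∀ b : α, Boolean b → b ∈ F ∨ neg b ∈ F

theorem le_neg_iff {a b : α} : a ≤ neg b ↔ mul a b ≤ ⊥ :=
  (residuation a b ⊥).symm

theorem le_neg_comm {a b : α} : a ≤ neg b ↔ b ≤ neg a := by
  rw [le_neg_iff, le_neg_iff, mul_comm]

theorem le_neg_neg (a : α) : a ≤ neg (neg a) :=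
  le_neg_comm.1 le_rfl

theorem neg_anti {a b : α} (hab : a ≤ b) : neg b ≤ neg a :=
  le_neg_comm.1 (hab.trans (le_neg_neg b))

theorem neg_neg_neg (a : α) : neg (neg (neg a)) = neg a :=
  le_antisymm (neg_anti (le_neg_neg a)) (le_neg_neg (neg a))

theorem neg_top : neg (⊤ : α) = ⊥ :=
  le_bot_iff.1 (by simpa only [mul_top] using le_neg_iff.1 (le_refl (neg (⊤ : α))))

theorem mul_le_mul_right {a b : α} (hab : a ≤ b) (c : α) : mul a c ≤ mul b c :=
  (residuation _ _ _).2 (hab.trans ((residuation _ _ _).1 le_rfl))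

theorem mul_le_mul {a b c d : α} (hab : a ≤ b) (hcd : c ≤ d) : mul a c ≤ mul b d := by
  refine (mul_le_mul_right hab c).trans ?_
  rw [mul_comm b c, mul_comm b d]
  exact mul_le_mul_right hcd b

theorem mul_le_left (a b : α) : mul a b ≤ a :=
  (mul_le_mul le_rfl le_top).trans_eq (mul_top a)

theorem mul_le_right (a b : α) : mul a b ≤ b :=
  (mul_comm a b).trans_le (mul_le_left b a)

theorem le_neg_mul_iff {a b c : α} : a ≤ neg (mul b c) ↔ mul a b ≤ neg c := by
  rw [le_neg_iff, le_neg_iff, mul_assoc]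

theorem neg_mul_neg_neg (a b : α) : neg (mul a (neg (neg b))) = neg (mul a b) :=
  eq_of_forall_le_iff fun c => by rw [le_neg_mul_iff, le_neg_mul_iff, neg_neg_neg]

theorem neg_neg_mul (a b : α) : neg (mul (neg (neg a)) b) = neg (mul a b) := by
  rw [mul_comm, neg_mul_neg_neg, mul_comm]

theorem pow_le_pow_left {a b : α} (hab : a ≤ b) : ∀ k : ℕ, pow a k ≤ pow b k
  | 0 => le_rfl
  | k + 1 => mul_le_mul hab (pow_le_pow_left hab k)

theorem pow_anti (a : α) : Antitone (pow a) :=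
  antitone_nat_of_succ_le fun k => mul_le_right a (pow a k)

theorem pow_le_self (a : α) {k : ℕ} (hk : 0 < k) : pow a k ≤ a := by
  cases k with
  | zero => exact absurd hk (lt_irrefl 0)
  | succ k => exact mul_le_left a (pow a k)

theorem neg_pow_neg_neg (a : α) (k : ℕ) : neg (pow (neg (neg a)) k) = neg (pow a k) := by
  induction k with
  | zero => rfl
  | succ k ih =>
    rw [pow, pow, neg_neg_mul, ← neg_mul_neg_neg a (pow (neg (neg a)) k), ih, neg_mul_neg_neg]

theorem nmul_eq_neg_pow_neg (k : ℕ) (a : α) : nmul k a = neg (pow (neg a) k) := by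
  induction k with
  | zero => exact neg_top.symm
  | succ k ih => rw [nmul, pow, add, ih, neg_mul_neg_neg]

theorem nmul_mono_right (k : ℕ) {a b : α} (hab : a ≤ b) : nmul k a ≤ nmul k b := by
  rw [nmul_eq_neg_pow_neg, nmul_eq_neg_pow_neg]
  exact neg_anti (pow_le_pow_left (neg_anti hab) k)

theorem nmul_mono_left (a : α) : Monotone fun k => nmul k a := fun j k hjk => by
  simp only [nmul_eq_neg_pow_neg]
  exact neg_anti (pow_anti (neg a) hjk)

theorem le_nmul (a : α) {k : ℕ} (hk : 0 < k) : a ≤ nmul k a := by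
  rw [nmul_eq_neg_pow_neg, le_neg_comm]
  exact pow_le_self (neg a) hk

theorem nmul_neg (k : ℕ) (a : α) : nmul k (neg a) = neg (pow a k) := by
  rw [nmul_eq_neg_pow_neg, neg_pow_neg_neg]

theorem boolean_mn_implies_wlk (m n : ℕ) (hm : 0 < m) (hn : 0 < n)
    (h : ∀ a : α, Boolean (nmul m (pow a n))) :
    ∀ k : ℕ, max m n ≤ k → ∀ a : α, nmul k a ⊔ nmul k (neg a) = ⊤ := by
  intro k hk a
  refine top_le_iff.1 ((h a).ge.trans (sup_le_sup ?_ ?_))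
  · exact (nmul_mono_right m (pow_le_self a hn)).trans
      (nmul_mono_left a ((le_max_left m n).trans hk))
  · rw [nmul_neg]
    exact neg_anti ((pow_anti a ((le_max_right m n).trans hk)).trans (le_nmul _ hm))

end BRL
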